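/- arXiv:0911.0105 — 2 statements merged into one kernel-verified Lean document; each statement's English description precedes it below -/
import Mathlib

section
/- No ({⊕, ↓} ∪ 𝒫)-definable numerical function f : ℕ → ℕ is regressive or semi-regressive. -/
noncomputable section
open Classical

/-- `s ⊕ t`: lifted addition on sets of naturals. -/
def setPlus (s t : Set ℕ) : Set ℕ := {u | ∃ m ∈ s, ∃ n ∈ t, u = m + n}

/-- `s ⊗ t`: lifted multiplication on sets of naturals. -/
def setTimes (s t : Set ℕ) : Set ℕ := {u | ∃ m ∈ s, ∃ n ∈ t, u = m * n}

/-- Sets of naturals definable by (variable-free) arithmetic circuits: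
the smallest collection containing `∅`, `ℕ`, all singletons, closed under
union, intersection, complement, `⊕` and `⊗`. -/
inductive ArithDefinable : Set ℕ → Prop
  | empty : ArithDefinable ∅
  | univ : ArithDefinable Set.univ
  | single (k : ℕ) : ArithDefinable {k}
  | union : ∀ {s t : Set ℕ}, ArithDefinable s → ArithDefinable t → ArithDefinable (s ∪ t)
  | inter : ∀ {s t : Set ℕ}, ArithDefinable s → ArithDefinable t → ArithDefinable (s ∩ t)
  | compl : ∀ {s : Set ℕ}, ArithDefinable s → ArithDefinable sᶜ
  | plus : ∀ {s t : Set ℕ}, ArithDefinable s → ArithDefinable t → ArithDefinable (setPlus s t)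
  | times : ∀ {s t : Set ℕ}, ArithDefinable s → ArithDefinable t → ArithDefinable (setTimes s t)

/-- A set-function of arity `k`. -/
abbrev SetFun (k : ℕ) := (Fin k → Set ℕ) → Set ℕ

/-- The `𝒪`-definable functions `ℙ^n → ℙ`, for a collection `O` of set-functions
(given per arity): smallest class containing projections and the constants
`∅`, `ℕ`, `{k}`, closed under pointwise union, intersection, complement, and
composition with functions in `O`. -/
inductive ODef (O : ∀ k, Set (SetFun k)) (n : ℕ) : SetFun n → Prop
  | proj (i : Fin n) : ODef O n (fun s => s i)
  | empty : ODef O n (fun _ => ∅)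
  | univ : ODef O n (fun _ => Set.univ)
  | single (k : ℕ) : ODef O n (fun _ => {k})
  | union : ∀ {F G : SetFun n}, ODef O n F → ODef O n G → ODef O n (fun s => F s ∪ G s)
  | inter : ∀ {F G : SetFun n}, ODef O n F → ODef O n G → ODef O n (fun s => F s ∩ G s)
  | compl : ∀ {F : SetFun n}, ODef O n F → ODef O n (fun s => (F s)ᶜ)
  | comp : ∀ {k : ℕ} {g : SetFun k} {F : Fin k → SetFun n},
      g ∈ O k → (∀ i, ODef O n (F i)) → ODef O n (fun s => g (fun i => F i s))

/-- `s_{|m} = s ∩ {0,…,m}`. -/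
def restrict (s : Set ℕ) (m : ℕ) : Set ℕ := s ∩ {k | k ≤ m}

/-- `F` is `h`-continuous on `D`. -/
def HCont (h : ℕ → ℕ) {n : ℕ} (F : SetFun n) (D : Set (Fin n → Set ℕ)) : Prop :=
  ∀ m : ℕ, ∀ s ∈ D, ∀ t ∈ D,
    (∀ i, restrict (s i) (h m) = restrict (t i) (h m)) →
    restrict (F s) m = restrict (F t) m

/-- `F` is uniformly continuous on `D`. -/
def UnifCont {n : ℕ} (F : SetFun n) (D : Set (Fin n → Set ℕ)) : Prop :=
  ∃ h : ℕ → ℕ, HCont h F D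

/-- `𝒰`: set-functions (of arity `k`) uniformly continuous on the whole space. -/
def Ucal (k : ℕ) : Set (SetFun k) := {g | UnifCont g Set.univ}

/-- `𝒫`: predicates, i.e. set-functions with values among `∅` and `{0}`. -/
def Pcal (k : ℕ) : Set (SetFun k) := {g | ∀ s, g s = ∅ ∨ g s = {0}}

/-- `𝒰 ∪ 𝒫`. -/
def UPcal (k : ℕ) : Set (SetFun k) := Ucal k ∪ Pcal k

/-- `Max(x)`. -/
def MaxFun (x : Set ℕ) : Set ℕ :=
  if x = ∅ then ∅ else if x.Infinite then Set.univ else {sSup x}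

/-- `Card(x)`. -/
def CardFun (x : Set ℕ) : Set ℕ := if x.Finite then {x.ncard} else Set.univ

/-- `↓(x)`. -/
def DownFun (x : Set ℕ) : Set ℕ := {m | ∃ n ∈ x, m ≤ n}

/-- `Sum(x)`. -/
def SumFun (x : Set ℕ) : Set ℕ := if x.Finite then {∑ᶠ n ∈ x, n} else Set.univ

/-- `Prod(x)`. -/
def ProdFun (x : Set ℕ) : Set ℕ := if x.Finite then {∏ᶠ n ∈ x, n} else Set.univ

/-- `Shove(x) = {n - min x : n ∈ x}` (empty for `x = ∅`). -/
def ShoveFun (x : Set ℕ) : Set ℕ := (fun n => n - sInf x) '' x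

/-- `ε(x)`: the test for emptiness. -/
def epsFun (x : Set ℕ) : Set ℕ := if x = ∅ then {0} else ∅

/-- `Fin(x)`: the test for finiteness. -/
def FinFun (x : Set ℕ) : Set ℕ := if x.Finite then {0} else ∅

/-- `⊕` as a set-function of arity 2. -/
def plusFun : SetFun 2 := fun s => setPlus (s 0) (s 1)

/-- `⊗` as a set-function of arity 2. -/
def timesFun : SetFun 2 := fun s => setTimes (s 0) (s 1)

/-- `↓` as a set-function of arity 1. -/
def downFun1 : SetFun 1 := fun s => DownFun (s 0)

/-- `ε` as a set-function of arity 1. -/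
def epsFun1 : SetFun 1 := fun s => epsFun (s 0)

/-- The collection `{⊕, ⊗}`. -/
def arithO : ∀ k, Set (SetFun k)
  | 2 => {plusFun, timesFun}
  | _ => ∅

/-- The collection `{⊕}`. -/
def addO : ∀ k, Set (SetFun k)
  | 2 => {plusFun}
  | _ => ∅

/-- The collection `{⊕, ↓} ∪ 𝒫`. -/
def addDownO : ∀ k, Set (SetFun k)
  | 1 => insert downFun1 (Pcal 1)
  | 2 => insert plusFun (Pcal 2)
  | k => Pcal k

/-- The collection `{⊕, ⊗, ↓} ∪ 𝒫`. -/
def arithDownO : ∀ k, Set (SetFun k)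
  | 1 => insert downFun1 (Pcal 1)
  | 2 => {plusFun, timesFun} ∪ Pcal 2
  | k => Pcal k

/-- The collection `𝒰 ∪ {ε}`. -/
def UEps : ∀ k, Set (SetFun k)
  | 1 => insert epsFun1 (Ucal 1)
  | k => Ucal k

/-- The collection `{⊕, ⊗} ∪ 𝒫`. -/
def arithPO (k : ℕ) : Set (SetFun k) := arithO k ∪ Pcal k

/-- A numerical function `ℕ → ℕ` is `O`-definable if some `O`-definable
set-function maps `{m}` to `{f m}` for every `m`. -/
def NumDef1 (O : ∀ k, Set (SetFun k)) (f : ℕ → ℕ) : Prop :=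
  ∃ F : SetFun 1, ODef O 1 F ∧ ∀ m : ℕ, F (fun _ => {m}) = {f m}

/-- A numerical function `ℕ^k → ℕ` is `O`-definable if some `O`-definable
set-function maps tuples of singletons to the corresponding singleton value. -/
def NumDef (O : ∀ k, Set (SetFun k)) (k : ℕ) (f : (Fin k → ℕ) → ℕ) : Prop :=
  ∃ F : SetFun k, ODef O k F ∧ ∀ m : Fin k → ℕ, F (fun i => ({m i} : Set ℕ)) = {f m}

/-- `f` is regressive: `{f n : f n < n}` is infinite. -/
def Regressive (f : ℕ → ℕ) : Prop := {y | ∃ n, f n = y ∧ y < n}.Infinite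

/-- `f` is semi-regressive: for every `ℓ` there is `n` with `n + ℓ ≤ f n ≤ 2n - 2`. -/
def SemiRegressive (f : ℕ → ℕ) : Prop :=
  ∀ ℓ : ℕ, ∃ n : ℕ, n + ℓ ≤ f n ∧ (f n : ℤ) ≤ 2 * (n : ℤ) - 2

lemma setPlus_comm (s t : Set ℕ) : setPlus s t = setPlus t s := by
  ext u
  constructor <;> rintro ⟨a, ha, b, hb, rfl⟩ <;> exact ⟨b, hb, a, ha, add_comm _ _⟩

/-- The sets `S n` do not separate two points of `[c, n - 1]`, nor two points of
`[n + c, 2 n - 2]`. -/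
def WindowConstant (c : ℕ) (S : ℕ → Set ℕ) : Prop :=
  ∀ n x y : ℕ,
    (c ≤ x → x < n → c ≤ y → y < n → x ∈ S n → y ∈ S n) ∧
    (n + c ≤ x → x + 2 ≤ 2 * n → n + c ≤ y → y + 2 ≤ 2 * n → x ∈ S n → y ∈ S n)

namespace WindowConstant

variable {c d : ℕ} {S T : ℕ → Set ℕ}

lemma mono (h : WindowConstant c S) (hcd : c ≤ d) : WindowConstant d S := fun n x y =>
  ⟨fun _ _ _ _ => (h n x y).1 (by omega) (by omega) (by omega) (by omega),
    fun _ _ _ _ => (h n x y).2 (by omega) (by omega) (by omega) (by omega)⟩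

lemma union (hS : WindowConstant c S) (hT : WindowConstant c T) :
    WindowConstant c (fun n => S n ∪ T n) := fun n x y =>
  ⟨fun h₁ h₂ h₃ h₄ =>
      Or.imp ((hS n x y).1 h₁ h₂ h₃ h₄) ((hT n x y).1 h₁ h₂ h₃ h₄),
    fun h₁ h₂ h₃ h₄ =>
      Or.imp ((hS n x y).2 h₁ h₂ h₃ h₄) ((hT n x y).2 h₁ h₂ h₃ h₄)⟩

lemma inter (hS : WindowConstant c S) (hT : WindowConstant c T) :
    WindowConstant c (fun n => S n ∩ T n) := fun n x y =>
  ⟨fun h₁ h₂ h₃ h₄ =>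
      And.imp ((hS n x y).1 h₁ h₂ h₃ h₄) ((hT n x y).1 h₁ h₂ h₃ h₄),
    fun h₁ h₂ h₃ h₄ =>
      And.imp ((hS n x y).2 h₁ h₂ h₃ h₄) ((hT n x y).2 h₁ h₂ h₃ h₄)⟩

lemma compl (hS : WindowConstant c S) : WindowConstant c (fun n => (S n)ᶜ) := fun n x y =>
  ⟨fun h₁ h₂ h₃ h₄ => mt ((hS n y x).1 h₃ h₄ h₁ h₂),
    fun h₁ h₂ h₃ h₄ => mt ((hS n y x).2 h₃ h₄ h₁ h₂)⟩

lemma of_forall_lt (h : ∀ n, ∀ x ∈ S n, x < c) : WindowConstant c S := fun n x _ =>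
  ⟨fun _ _ _ _ hx => by have := h n x hx; omega,
    fun _ _ _ _ hx => by have := h n x hx; omega⟩

lemma singleton_self : WindowConstant 1 (fun n => {n}) := by
  intro n x y
  simp only [Set.mem_singleton_iff]
  omega

lemma downFun (hS : WindowConstant c S) : WindowConstant c (fun n => DownFun (S n)) := by
  intro n x y
  constructor
  · rintro h₁ h₂ h₃ h₄ ⟨m, hm, hxm⟩
    by_cases hmn : m < n
    · exact ⟨y, (hS n m y).1 (by omega) hmn h₃ h₄ hm, le_rfl⟩
    · exact ⟨m, hm, by omega⟩
  · rintro h₁ h₂ h₃ h₄ ⟨m, hm, hxm⟩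
    by_cases hmn : m + 2 ≤ 2 * n
    · exact ⟨y, (hS n m y).2 (by omega) hmn h₃ h₄ hm, le_rfl⟩
    · exact ⟨m, hm, by omega⟩

lemma setPlus_lower (hS : WindowConstant c S) (hT : WindowConstant c T) {n a b y : ℕ}
    (ha : a ∈ S n) (hb : b ∈ T n) (hba : b ≤ a) (h₁ : 2 * c ≤ a + b) (h₂ : a + b < n)
    (h₃ : 2 * c ≤ y) (h₄ : y < n) : y ∈ setPlus (S n) (T n) := by
  have hSn : ∀ x, c ≤ x → x < n → x ∈ S n := fun x hx hxn =>
    (hS n a x).1 (by omega) (by omega) hx hxn ha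
  by_cases hbc : b < c
  · exact ⟨y - b, hSn _ (by omega) (by omega), b, hb, by omega⟩
  · exact ⟨c, hSn _ le_rfl (by omega), y - c,
      (hT n b _).1 (by omega) (by omega) (by omega) (by omega) hb, by omega⟩

lemma setPlus_upper (hS : WindowConstant c S) (hT : WindowConstant c T) {n a b y : ℕ}
    (ha : a ∈ S n) (hb : b ∈ T n) (hba : b ≤ a) (h₁ : n + 2 * c ≤ a + b)
    (h₂ : a + b + 2 ≤ 2 * n) (h₃ : n + 2 * c ≤ y) (h₄ : y + 2 ≤ 2 * n) :
    y ∈ setPlus (S n) (T n) := by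
  by_cases hbc : b < c
  · exact ⟨y - b, (hS n a _).2 (by omega) (by omega) (by omega) (by omega) ha, b, hb,
      by omega⟩
  have hTn : ∀ x, c ≤ x → x < n → x ∈ T n := fun x hx hxn =>
    (hT n b x).1 (by omega) (by omega) hx hxn hb
  by_cases han : a < n
  · exact ⟨n - 1, (hS n a _).1 (by omega) han (by omega) (by omega) ha, y - (n - 1),
      hTn _ (by omega) (by omega), by omega⟩
  by_cases hac : a < n + c
  · exact ⟨a, ha, y - a, hTn _ (by omega) (by omega), by omega⟩
  · exact ⟨y - c, (hS n a _).2 (by omega) (by omega) (by omega) (by omega) ha, c,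
      hTn _ le_rfl (by omega), by omega⟩

lemma setPlus (hS : WindowConstant c S) (hT : WindowConstant c T) :
    WindowConstant (2 * c) (fun n => setPlus (S n) (T n)) := by
  intro n x y
  constructor
  · rintro h₁ h₂ h₃ h₄ ⟨a, ha, b, hb, rfl⟩
    rcases le_total b a with hba | hab
    · exact setPlus_lower hS hT ha hb hba h₁ h₂ h₃ h₄
    · beta_reduce
      rw [setPlus_comm]
      exact setPlus_lower hT hS hb ha hab (by omega) (by omega) h₃ h₄
  · rintro h₁ h₂ h₃ h₄ ⟨a, ha, b, hb, rfl⟩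
    rcases le_total b a with hba | hab
    · exact setPlus_upper hS hT ha hb hba h₁ h₂ h₃ h₄
    · beta_reduce
      rw [setPlus_comm]
      exact setPlus_upper hT hS hb ha hab (by omega) (by omega) h₃ h₄

end WindowConstant

lemma mem_addDownO {k : ℕ} {g : SetFun k} (hg : g ∈ addDownO k) :
    g ∈ Pcal k ∨ (∃ h : k = 1, h ▸ g = downFun1) ∨ ∃ h : k = 2, h ▸ g = plusFun := by
  match k, g, hg with
  | 0, _, hg => exact Or.inl hg
  | 1, _, hg => exact hg.elim (fun h => Or.inr (Or.inl ⟨rfl, h⟩)) Or.inl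
  | 2, _, hg => exact hg.elim (fun h => Or.inr (Or.inr ⟨rfl, h⟩)) Or.inl
  | _ + 3, _, hg => exact Or.inl hg

lemma ODef.exists_windowConstant {F : SetFun 1} (hF : ODef addDownO 1 F) :
    ∃ c, WindowConstant c (fun n => F (fun _ => {n})) := by
  induction hF with
  | proj i => exact ⟨1, WindowConstant.singleton_self⟩
  | empty => exact ⟨0, fun _ _ _ => ⟨fun _ _ _ _ h => h, fun _ _ _ _ h => h⟩⟩
  | univ => exact ⟨0, fun _ _ _ => ⟨fun _ _ _ _ _ => trivial, fun _ _ _ _ _ => trivial⟩⟩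
  | single k =>
    exact ⟨k + 1, WindowConstant.of_forall_lt fun _ x hx => by
      rw [Set.mem_singleton_iff.1 hx]; exact Nat.lt_succ_self k⟩
  | union _ _ ihF ihG =>
    obtain ⟨c, hc⟩ := ihF
    obtain ⟨d, hd⟩ := ihG
    exact ⟨max c d, (hc.mono (le_max_left c d)).union (hd.mono (le_max_right c d))⟩
  | inter _ _ ihF ihG =>
    obtain ⟨c, hc⟩ := ihF
    obtain ⟨d, hd⟩ := ihG
    exact ⟨max c d, (hc.mono (le_max_left c d)).inter (hd.mono (le_max_right c d))⟩
  | compl _ ih =>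
    obtain ⟨c, hc⟩ := ih
    exact ⟨c, hc.compl⟩
  | @comp k g G hg _ ih =>
    rcases mem_addDownO hg with hP | ⟨rfl, hg'⟩ | ⟨rfl, hg'⟩
    · refine ⟨1, WindowConstant.of_forall_lt fun n x hx => ?_⟩
      rcases hP (fun i => G i fun _ => {n}) with h | h <;> simp_all
    · obtain ⟨c, hc⟩ := ih 0
      subst hg'
      exact ⟨c, hc.downFun⟩
    · obtain ⟨c, hc⟩ := ih 0
      obtain ⟨d, hd⟩ := ih 1
      subst hg'
      exact ⟨2 * max c d,
        (hc.mono (le_max_left c d)).setPlus (hd.mono (le_max_right c d))⟩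

theorem addDown_no_regressive_or_semiregressive :
    ∀ f : ℕ → ℕ, NumDef1 addDownO f → ¬ Regressive f ∧ ¬ SemiRegressive f := by
  rintro f ⟨F, hF, hf⟩
  obtain ⟨c, hc⟩ := hF.exists_windowConstant
  simp only [WindowConstant, hf, Set.mem_singleton_iff] at hc
  constructor
  · intro hreg
    obtain ⟨y, ⟨n, hy, hyn⟩, hcy⟩ := hreg.exists_gt c
    have := (hc n y c).1 hcy.le hyn le_rfl (by omega) hy.symm
    omega
  · intro hsemi
    obtain ⟨n, h₁, h₂⟩ := hsemi (c + 1)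
    have := (hc n (f n) (n + c)).2 (by omega) (by omega) le_rfl (by omega) rfl
    omega

end
end

section
/- The numerical function f : ℕ → ℕ mapping each n to the smallest prime greater than n is definable by an arithmetic circuit (i.e. {⊕,⊗}-definable), and f is semi-regressive; in particular, some arithmetic circuit defines a semi-regressive function. -/
noncomputable section
open Classical

theorem ODef.setPlus {n : ℕ} {F G : SetFun n} (hF : ODef arithO n F) (hG : ODef arithO n G) :
    ODef arithO n (fun s => setPlus (F s) (G s)) :=
  ODef.comp (k := 2) (g := plusFun) (F := ![F, G]) (Or.inl rfl)
    (by intro i; fin_cases i <;> assumption)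

theorem ODef.setTimes {n : ℕ} {F G : SetFun n} (hF : ODef arithO n F) (hG : ODef arithO n G) :
    ODef arithO n (fun s => setTimes (F s) (G s)) :=
  ODef.comp (k := 2) (g := timesFun) (F := ![F, G]) (Or.inr rfl)
    (by intro i; fin_cases i <;> assumption)

/-- The set of primes, built from singletons by Boolean operations and lifted multiplication. -/
def primesCircuit : Set ℕ := ({0} ∪ {1} ∪ setTimes ({0} ∪ {1})ᶜ ({0} ∪ {1})ᶜ)ᶜ

theorem mem_primesCircuit {p : ℕ} : p ∈ primesCircuit ↔ p.Prime := by
  simp only [primesCircuit, setTimes, Set.mem_compl_iff, Set.mem_union, Set.mem_singleton_iff,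
    Set.mem_ofPred_eq, not_or, not_exists, not_and]
  constructor
  · rintro ⟨⟨h0, h1⟩, h⟩
    refine Nat.prime_def_minFac.2 ⟨by omega, ?_⟩
    obtain ⟨c, hc⟩ := Nat.minFac_dvd p
    by_cases hc1 : c = 1
    · rw [hc1, mul_one] at hc
      exact hc.symm
    · refine absurd hc (h _ ⟨(Nat.minFac_pos p).ne', ?_⟩ c ⟨?_, hc1⟩)
      · exact fun h => h1 (Nat.minFac_eq_one_iff.1 h)
      · rintro rfl
        exact h0 (by simpa using hc)
  · intro hp
    refine ⟨⟨hp.ne_zero, hp.ne_one⟩, ?_⟩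
    rintro a ⟨-, ha⟩ b ⟨-, hb⟩ rfl
    exact Nat.not_prime_mul ha hb hp

theorem ODef.primesCircuit {n : ℕ} : ODef arithO n (fun _ => primesCircuit) :=
  have h01 := ODef.union (O := arithO) (n := n) (.single 0) (.single 1)
  .compl (.union h01 (.setTimes (.compl h01) (.compl h01)))

theorem mem_setPlus_compl_zero {s : Set ℕ} {u : ℕ} :
    u ∈ setPlus s {0}ᶜ ↔ ∃ m ∈ s, m < u := by
  simp only [setPlus, Set.mem_compl_iff, Set.mem_singleton_iff, Set.mem_ofPred_eq]
  constructor
  · rintro ⟨m, hm, n, hn, rfl⟩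
    exact ⟨m, hm, by omega⟩
  · rintro ⟨m, hm, h⟩
    exact ⟨m, hm, u - m, by omega, by omega⟩

theorem numDef1_nextPrime (f : ℕ → ℕ)
    (hf : ∀ n : ℕ, (f n).Prime ∧ n < f n ∧ ∀ q : ℕ, q.Prime → n < q → f n ≤ q) :
    NumDef1 arithO f := by
  have hpos : ODef arithO 1 (fun _ => {0}ᶜ) := .compl (.single 0)
  have hA : ODef arithO 1 (fun s => primesCircuit ∩ setPlus (s 0) {0}ᶜ) :=
    .inter .primesCircuit (.setPlus (.proj 0) hpos)
  refine ⟨_, .inter hA (.compl (.setPlus hA hpos)), fun m => ?_⟩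
  obtain ⟨hp, hlt, hmin⟩ := hf m
  ext u
  simp only [Set.mem_inter_iff, Set.mem_compl_iff, mem_setPlus_compl_zero, mem_primesCircuit,
    Set.mem_singleton_iff, exists_eq_left]
  constructor
  · rintro ⟨⟨hu, hmu⟩, h⟩
    exact le_antisymm (not_lt.1 fun hfu => h ⟨f m, ⟨hp, hlt⟩, hfu⟩) (hmin u hu hmu)
  · rintro rfl
    exact ⟨⟨hp, hlt⟩, fun ⟨q, ⟨hq, hmq⟩, hqf⟩ => (hmin q hq hmq).not_gt hqf⟩

theorem not_prime_factorial_add {k i : ℕ} (hi : 2 ≤ i) (hik : i ≤ k) :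
    ¬ (k.factorial + i).Prime := fun hp => by
  have hdvd : i ∣ k.factorial + i :=
    (Nat.dvd_factorial (by omega) hik).add (dvd_refl i)
  have := Nat.factorial_pos k
  rcases hp.eq_one_or_self_of_dvd i hdvd with h | h <;> omega

theorem semiRegressive_nextPrime (f : ℕ → ℕ)
    (hf : ∀ n : ℕ, (f n).Prime ∧ n < f n ∧ ∀ q : ℕ, q.Prime → n < q → f n ≤ q) :
    SemiRegressive f := by
  intro l
  obtain ⟨hp, hlt, hmin⟩ := hf ((l + 2).factorial + 2)
  refine ⟨(l + 2).factorial + 2, ?_, ?_⟩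
  · by_contra! h
    refine not_prime_factorial_add (k := l + 2) (i := f ((l + 2).factorial + 2) - (l + 2).factorial)
      (by omega) (by omega) ?_
    rwa [Nat.add_sub_cancel' (by omega)]
  · obtain ⟨q, hq, hlq, hqle⟩ :=
      Nat.exists_prime_lt_and_le_two_mul ((l + 2).factorial + 1) (by omega)
    have hne : q ≠ (l + 2).factorial + 2 := by
      rintro rfl
      exact not_prime_factorial_add le_rfl (by omega) hq
    have := hmin q hq (by omega)
    omega

theorem next_prime_arith_definable_and_semiregressive (f : ℕ → ℕ)
    (hf : ∀ n : ℕ, (f n).Prime ∧ n < f n ∧ ∀ q : ℕ, q.Prime → n < q → f n ≤ q) :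
    NumDef1 arithO f ∧ SemiRegressive f :=
  ⟨numDef1_nextPrime f hf, semiRegressive_nextPrime f hf⟩

end
end
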